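/- arXiv:2603.23681 — 2 statements merged into one kernel-verified Lean document; each statement's English description precedes it below -/
import Mathlib

section
/- (Winkler's theorem.) Let G be a finite connected graph on n+1 vertices, let G′ be an arbitrary orientation of G, let T be an arbitrary spanning tree of G, and let e_1 = (a_1,b_1), …, e_n = (a_n,b_n) denote the edges of T oriented as in G′. Then G is of QE class if and only if the n×n matrix [K(e_i,e_j)]_{i,j=1,…,n}, where K(e_i,e_j) = ½(d_G(a_i,b_j) − d_G(a_i,a_j) − d_G(b_i,b_j) + d_G(b_i,a_j)), is positive semidefinite. -/
open Matrix in
open scoped ComplexOrder MatrixOrder Matrix.Norms.L2Operator in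
/-- A positive semidefinite matrix is the Gram matrix of vectors in Euclidean space. -/
theorem Matrix.PosSemidef.exists_eq_gram {ι : Type*} [Fintype ι] {A : Matrix ι ι ℝ}
    (hA : A.PosSemidef) : ∃ v : ι → EuclideanSpace ℝ ι, A = gram ℝ v := by
  classical
  obtain ⟨B, rfl⟩ := CStarAlgebra.nonneg_iff_eq_star_mul_self.mp hA.nonneg
  refine ⟨fun i => WithLp.toLp 2 (B.col i), ?_⟩
  ext i j
  simp [star_eq_conjTranspose, mul_apply, PiLp.inner_apply, mul_comm]

/-- Edge differences telescope: the difference of any function between two vertices of a connected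
graph is a fixed linear combination of its differences along the (oriented) edges. -/
theorem SimpleGraph.Reachable.exists_coeff {V ι : Type*} [Fintype ι] {T : SimpleGraph V}
    {a b : ι → V} (hsurj : ∀ e ∈ T.edgeSet, ∃ i, s(a i, b i) = e) {r x : V}
    (h : T.Reachable x r) :
    ∃ c : ι → ℝ, ∀ f : V → ℝ, ∑ i, c i * (f (b i) - f (a i)) = f x - f r := by
  classical
  obtain ⟨p⟩ := h
  induction p with
  | nil => exact ⟨0, by simp⟩
  | @cons u v w huv p ih =>
    obtain ⟨c, hc⟩ := ih
    obtain ⟨i, hi⟩ := hsurj s(u, v) huv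
    obtain ⟨rfl, rfl⟩ | ⟨rfl, rfl⟩ := Sym2.eq_iff.mp hi
    · refine ⟨c - Pi.single i 1, fun f => ?_⟩
      simp [sub_mul, Finset.sum_sub_distrib, hc, Pi.single_apply]
    · refine ⟨c + Pi.single i 1, fun f => ?_⟩
      simp [add_mul, Finset.sum_add_distrib, hc, Pi.single_apply]

/-- The inner product of two differences, in terms of squared distances. -/
theorem real_inner_sub_sub_eq_norm_sub_sq {E : Type*} [NormedAddCommGroup E]
    [InnerProductSpace ℝ E] (p q r s : E) :
    inner ℝ (q - p) (s - r) =
      (‖p - s‖ ^ 2 - ‖p - r‖ ^ 2 - ‖q - s‖ ^ 2 + ‖q - r‖ ^ 2) / 2 := by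
  simp only [norm_sub_sq_real, inner_sub_left, inner_sub_right]
  ring


/-- A finite graph is of QE class if it admits a quadratic embedding into
Euclidean space: `‖φ x - φ y‖² = d_G(x,y)` for all vertices `x, y`. -/
def IsQEClass {V : Type*} [Fintype V] (G : SimpleGraph V) : Prop :=
  ∃ φ : V → EuclideanSpace ℝ (Fin (Fintype.card V)),
    ∀ x y : V, ‖φ x - φ y‖ ^ 2 = (G.dist x y : ℝ)

/-- Winkler's theorem: Let `G` be a connected graph on `n+1` vertices,
`T` a spanning tree of `G` whose edges, oriented arbitrarily (as in an orientation
`G'` of `G`), are `e_i = (a i, b i)` for `i = 1, …, n`. Then `G` is of QE class iff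
the matrix `K(e_i,e_j) = ½(d_G(a_i,b_j) − d_G(a_i,a_j) − d_G(b_i,b_j) + d_G(b_i,a_j))`
is positive semidefinite. -/
theorem winkler_tree {V : Type*} [Fintype V] [DecidableEq V] {n : ℕ}
    (G : SimpleGraph V) (hG : G.Connected) (hcard : Fintype.card V = n + 1)
    (T : SimpleGraph V) (hTG : T ≤ G) (hT : T.IsTree)
    (a b : Fin n → V) (hadj : ∀ i, T.Adj (a i) (b i))
    (hinj : Function.Injective fun i => s(a i, b i))
    (hsurj : ∀ e ∈ T.edgeSet, ∃ i, s(a i, b i) = e) :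
    IsQEClass G ↔
      (Matrix.of fun i j : Fin n =>
        (((G.dist (a i) (b j) : ℝ) - (G.dist (a i) (a j) : ℝ)
          - (G.dist (b i) (b j) : ℝ) + (G.dist (b i) (a j) : ℝ)) / 2)).PosSemidef := by
  constructor
  · rintro ⟨φ, hφ⟩
    have hgram := Matrix.posSemidef_gram ℝ fun i => φ (b i) - φ (a i)
    simp only [Matrix.gram, real_inner_sub_sub_eq_norm_sub_sq, hφ] at hgram
    exact hgram
  · intro hK
    obtain ⟨r⟩ := hG.nonempty
    choose c hc using fun x => (hT.connected.preconnected x r).exists_coeff hsurj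
    obtain ⟨v, hv⟩ := (hK.mul_mul_conjTranspose_same (Matrix.of c)).exists_eq_gram
    have hinner (x y : V) : inner ℝ (v x) (v y) =
        ((G.dist x r : ℝ) + G.dist r y - G.dist x y) / 2 := by
      rw [← Matrix.gram_apply, ← hv, Matrix.mul_assoc]
      simp only [Matrix.mul_apply, Matrix.of_apply, Matrix.conjTranspose_apply, star_trivial]
      have hcol (i : Fin n) : ∑ j, ((G.dist (a i) (b j) : ℝ) - (G.dist (a i) (a j) : ℝ)
          - (G.dist (b i) (b j) : ℝ) + (G.dist (b i) (a j) : ℝ)) / 2 * c y j =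
          (((G.dist (b i) r : ℝ) - G.dist (b i) y) / 2 -
            ((G.dist (a i) r : ℝ) - G.dist (a i) y) / 2) := by
        trans ∑ j, c y j *
          (((G.dist (a i) (b j) : ℝ) - G.dist (b i) (b j)) / 2 -
            ((G.dist (a i) (a j) : ℝ) - G.dist (b i) (a j)) / 2)
        · exact Finset.sum_congr rfl fun j _ => by ring
        · rw [hc y fun z => ((G.dist (a i) z : ℝ) - G.dist (b i) z) / 2]
          ring
      simp only [hcol]
      rw [hc x fun z => ((G.dist z r : ℝ) - G.dist z y) / 2]
      simp only [SimpleGraph.dist_self, Nat.cast_zero]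
      ring
    refine ⟨fun x => LinearIsometryEquiv.piLpCongrLeft 2 ℝ ℝ (Fintype.equivFin V) (v x),
      fun x y => ?_⟩
    rw [← map_sub, LinearIsometryEquiv.norm_map, norm_sub_sq_real, ← real_inner_self_eq_norm_sq,
      ← real_inner_self_eq_norm_sq, hinner, hinner, hinner, G.dist_comm (u := r) (v := x),
      G.dist_comm (u := r) (v := y)]
    simp only [SimpleGraph.dist_self, Nat.cast_zero]
    ring
end

section
/- Let N be the real 8×8 symmetric matrix with rows (2,0,0,1,0,0,1,0), (0,2,1,0,0,1,0,0), (0,1,2,−1,0,0,1,0), (1,0,−1,2,0,1,0,0), (0,0,0,0,2,0,−1,−1), (0,1,0,1,0,2,0,−1), (1,0,1,0,−1,0,2,0), (0,0,0,0,−1,−1,0,2). Then the characteristic polynomial of N equals λ(λ−4)(λ³−6λ²+9λ−3)(λ³−6λ²+9λ−1) = λ⁸−16λ⁷+102λ⁶−328λ⁵+553λ⁴−456λ³+147λ²−12λ; in particular N is positive semidefinite. -/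
open Polynomial

/-- Twice the Winkler kernel matrix for a spanning tree of `Θ(2,3,5)`. -/
noncomputable def N235 : Matrix (Fin 8) (Fin 8) ℝ :=
  !![2, 0, 0, 1, 0, 0, 1, 0;
     0, 2, 1, 0, 0, 1, 0, 0;
     0, 1, 2, -1, 0, 0, 1, 0;
     1, 0, -1, 2, 0, 1, 0, 0;
     0, 0, 0, 0, 2, 0, -1, -1;
     0, 1, 0, 1, 0, 2, 0, -1;
     1, 0, 1, 0, -1, 0, 2, 0;
     0, 0, 0, 0, -1, -1, 0, 2]

section

open Matrix

theorem N235_posSemidef : N235.PosSemidef := by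
  refine .of_dotProduct_mulVec_nonneg ?_ fun x ↦ ?_
  · ext i j
    fin_cases i <;> fin_cases j <;> simp [N235]
  · have h : star x ⬝ᵥ (N235 *ᵥ x) =
        2 * (x 0 + x 3 / 2 + x 6 / 2) ^ 2 + 2 * (x 1 + x 2 / 2 + x 5 / 2) ^ 2
        + 3 / 2 * (x 2 - 2 / 3 * x 3 - x 5 / 3 + 2 / 3 * x 6) ^ 2
        + 5 / 6 * (x 3 + 4 / 5 * x 5 + x 6 / 5) ^ 2
        + 2 * (x 4 - x 6 / 2 - x 7 / 2) ^ 2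
        + 4 / 5 * (x 5 + x 6 / 4 - 5 / 4 * x 7) ^ 2 + 1 / 4 * (x 6 - x 7) ^ 2 := by
      simp [N235, dotProduct, Matrix.mulVec, Fin.sum_univ_eight]
      ring
    rw [h]
    positivity

theorem det_fromBlocks_scalar {n R : Type*} [Fintype n] [DecidableEq n] [CommRing R]
    [IsDomain R] {s : R} (hs : s ≠ 0) (B C : Matrix n n R) :
    (fromBlocks (scalar n s) B C (scalar n s)).det = (scalar n (s ^ 2) - B * C).det := by
  have h : fromBlocks (scalar n s) B C (scalar n s) * fromBlocks (scalar n s) 0 (-C) 1 =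
      fromBlocks (scalar n (s ^ 2) - B * C) B 0 (scalar n s) := by
    rw [fromBlocks_multiply]
    congr 1
    · simp [sq, sub_eq_add_neg, -scalar_apply]
    · simp
    · rw [← (scalar_commute s (Commute.all s) C).eq]
      simp [-scalar_apply]
    · simp
  refine mul_right_cancel₀ (pow_ne_zero (Fintype.card n) hs) ?_
  simpa [det_fromBlocks_zero₁₂, det_fromBlocks_zero₂₁] using congrArg det h

/-- The nonzero entries of `N235 - 2` join `{0, 2, 4, 5}` to `{1, 3, 6, 7}`. -/
noncomputable def N235Bipartition : Fin 4 ⊕ Fin 4 ≃ Fin 8 :=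
  Equiv.ofBijective (Sum.elim ![0, 2, 4, 5] ![1, 3, 6, 7]) (by decide)

theorem N235_charpoly : N235.charpoly =
    X ^ 8 - 16 * X ^ 7 + 102 * X ^ 6 - 328 * X ^ 5 + 553 * X ^ 4
      - 456 * X ^ 3 + 147 * X ^ 2 - 12 * X := by
  let B : Matrix (Fin 4) (Fin 4) ℝ[X] :=
    !![0, -1, -1, 0; -1, 1, -1, 0; 0, 0, 1, 1; -1, -1, 0, 1]
  have h : N235.charmatrix.submatrix N235Bipartition N235Bipartition =
      fromBlocks (scalar _ (X - 2)) B Bᵀ (scalar _ (X - 2)) := by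
    ext1 i j
    rcases i with i | i <;> rcases j with j | j <;> fin_cases i <;> fin_cases j <;>
      simp [N235, N235Bipartition, B, map_ofNat C 2]
  have hX : (X - 2 : ℝ[X]) ≠ 0 := by simpa only [map_ofNat] using X_sub_C_ne_zero (2 : ℝ)
  have hB : scalar (Fin 4) ((X - 2) ^ 2) - B * Bᵀ =
      !![(X - 2) ^ 2 - 2, 0, 1, -1;
         0, (X - 2) ^ 2 - 3, 1, 0;
         1, 1, (X - 2) ^ 2 - 2, -1;
         -1, 0, -1, (X - 2) ^ 2 - 3] := by
    ext1 i j
    rw [Matrix.sub_apply, mul_apply, Fin.sum_univ_four]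
    fin_cases i <;> fin_cases j <;> simp [B] <;> norm_num
  rw [charpoly, ← det_submatrix_equiv_self N235Bipartition, h, det_fromBlocks_scalar hX, hB]
  simp [det_succ_row_zero, Fin.sum_univ_succ, Fin.succAbove]
  ring

end

/-- The characteristic polynomial of `N235` is
`λ⁸−16λ⁷+102λ⁶−328λ⁵+553λ⁴−456λ³+147λ²−12λ
 = λ(λ−4)(λ³−6λ²+9λ−3)(λ³−6λ²+9λ−1)`; in particular `N235` is positive
semidefinite. -/
theorem N235_charpoly_posSemidef :
    N235.charpoly = X ^ 8 - 16 * X ^ 7 + 102 * X ^ 6 - 328 * X ^ 5 + 553 * X ^ 4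
        - 456 * X ^ 3 + 147 * X ^ 2 - 12 * X ∧
    N235.charpoly = X * (X - 4) * (X ^ 3 - 6 * X ^ 2 + 9 * X - 3)
        * (X ^ 3 - 6 * X ^ 2 + 9 * X - 1) ∧
    N235.PosSemidef := by
  refine ⟨N235_charpoly, ?_, N235_posSemidef⟩
  rw [N235_charpoly]
  ring
end
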